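/- Truth lemma for the canonical model: for every formula A of L(∀,□) and every Γ ∈ MC, the canonical structure satisfies 𝒜^MC, v^MC, Γ ⊨ A if and only if A ∈ Γ. -/

import Mathlib

namespace FOLBoxPaper

/-- Formulas of the language L(∀,□): atoms `P_j(x₁,…,xₙ)` (predicate index and
list of variables), identity `x = y`, negation, implication, universal
quantification, and the modal operator □. Variables are natural numbers. -/
inductive Formula : Type
  | atom : ℕ → List ℕ → Formula
  | eq : ℕ → ℕ → Formula
  | neg : Formula → Formula
  | imp : Formula → Formula → Formula
  | all : ℕ → Formula → Formula
  | box : Formula → Formula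

namespace Formula

/-- Conjunction, defined as usual. -/
def and (A B : Formula) : Formula := neg (imp A (neg B))

/-- Disjunction, defined as usual. -/
def or (A B : Formula) : Formula := imp (neg A) B

/-- Biconditional, defined as usual. -/
def iff (A B : Formula) : Formula := (imp A B).and (imp B A)

/-- ◇A := ¬□¬A. -/
def dia (A : Formula) : Formula := neg (box (neg A))

/-- ∃xA := ¬∀x¬A. -/
def ex (x : ℕ) (A : Formula) : Formula := neg (all x (neg A))

/-- A formula is □-free when it contains no occurrence of □. -/
def BoxFree : Formula → Prop
  | atom _ _ => True
  | eq _ _ => True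
  | neg A => BoxFree A
  | imp A B => BoxFree A ∧ BoxFree B
  | all _ A => BoxFree A
  | box _ => False

/-- `FreeIn x A`: the variable x has at least one ∀□-free occurrence in A,
i.e. an occurrence that is neither in the scope of a quantifier binding x
nor in the scope of □. -/
def FreeIn (x : ℕ) : Formula → Prop
  | atom _ args => x ∈ args
  | eq a b => x = a ∨ x = b
  | neg A => FreeIn x A
  | imp A B => FreeIn x A ∨ FreeIn x B
  | all z A => z ≠ x ∧ FreeIn x A
  | box _ => False

/-- The ∀□-free substitution `A(y/x)`: replace every ∀□-free occurrence of x
in A by y (occurrences in the scope of □ or of a quantifier binding x are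
left untouched). -/
def subst (A : Formula) (y x : ℕ) : Formula :=
  match A with
  | atom j args => atom j (args.map fun z => if z = x then y else z)
  | eq a b => eq (if a = x then y else a) (if b = x then y else b)
  | neg A => neg (subst A y x)
  | imp A B => imp (subst A y x) (subst B y x)
  | all z A => if z = x then all z A else all z (subst A y x)
  | box A => box A

/-- `Substitutable y x A`: the variable y is substitutable for the ∀□-free
occurrences of x in A, i.e. y is not captured by a quantifier when it
replaces x. -/
def Substitutable (y x : ℕ) : Formula → Prop
  | atom _ _ => True
  | eq _ _ => True
  | neg A => Substitutable y x A
  | imp A B => Substitutable y x A ∧ Substitutable y x B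
  | all z A => z = x ∨ ¬ FreeIn x A ∨ (z ≠ y ∧ Substitutable y x A)
  | box _ => True

end Formula

open Formula

/-- A first-order structure with variable domains:
a nonempty set of possible worlds, a nonempty domain of objects for each
world, and a world-relative interpretation of the predicate symbols. -/
structure Structure where
  W : Type
  wNonempty : Nonempty W
  D : W → Type
  dNonempty : ∀ w, Nonempty (D w)
  I : ℕ → (w : W) → List (D w) → Prop

/-- A valuation assigns, to each variable and world, an object of the domain
of that world. -/
def Valuation (M : Structure) : Type := ℕ → (w : M.W) → M.D w

open Classical in
/-- The variant `v^a_x(w)` of a valuation v at world w: it maps x at w to a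
and agrees with v everywhere else. -/
noncomputable def updateVal {M : Structure} (v : Valuation M) (x : ℕ)
    (w : M.W) (a : M.D w) : Valuation M :=
  fun y w' => if h : y = x ∧ w' = w then cast (congrArg M.D h.2.symm) a else v y w'

/-- Satisfaction `M, v, w ⊨ A`. The clause for □ quantifies over all
valuations and all worlds of the structure. -/
def Sat (M : Structure) : Valuation M → M.W → Formula → Prop
  | v, w, .atom j args => M.I j w (args.map fun z => v z w)
  | v, w, .eq a b => v a w = v b w
  | v, w, .neg A => ¬ Sat M v w A
  | v, w, .imp A B => Sat M v w A → Sat M v w B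
  | v, w, .all x A => ∀ a : M.D w, Sat M (updateVal v x w a) w A
  | _, _, .box A => ∀ (v' : Valuation M) (w' : M.W), Sat M v' w' A

/-- `M ⊨ A`: A is satisfied at every valuation and world of M. -/
def Models (M : Structure) (A : Formula) : Prop := ∀ v w, Sat M v w A

/-- Universal structures: M is universal when every □-free formula true
everywhere in M is true everywhere in every structure. -/
def Universal (M : Structure) : Prop :=
  ∀ B, BoxFree B → Models M B → ∀ N : Structure, Models N B

/-- Logical validity: truth at every valuation and world of every universal
structure. -/
def Valid (A : Formula) : Prop :=
  ∀ M : Structure, Universal M → ∀ (v : Valuation M) (w : M.W), Sat M v w A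

/-- FOL: the set of □-free classical first-order theses, i.e. □-free formulas
satisfied at every valuation and world of every structure. -/
def FOL : Set Formula := {A | BoxFree A ∧ ∀ M : Structure, Models M A}

/-- `PropTaut A`: A is an instantiation of a tautology of classical
propositional logic (it is true under every assignment of truth values to
formulas that respects ¬ and →). -/
def PropTaut (A : Formula) : Prop :=
  ∀ f : Formula → Prop,
    (∀ B, f (neg B) ↔ ¬ f B) → (∀ B C, f (imp B C) ↔ (f B → f C)) → f A

/-- The system FOL□. -/
inductive FOLBox : Formula → Prop
  | taut {A} : PropTaut A → FOLBox A
  | axK {A B} : FOLBox ((box (A.imp B)).imp ((box A).imp (box B)))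
  | axT {A} : FOLBox ((box A).imp A)
  | ax5 {A} : FOLBox ((neg (box A)).imp (box (neg (box A))))
  | axAll1 {A : Formula} {x y : ℕ} : Substitutable y x A →
      FOLBox ((all x A).imp (A.subst y x))
  | axAll2 {A B : Formula} {x : ℕ} : ¬ FreeIn x A →
      FOLBox ((all x (A.imp B)).imp (A.imp (all x B)))
  | axId {x : ℕ} : FOLBox (Formula.eq x x)
  | axEq {A : Formula} {x y : ℕ} : BoxFree A → Substitutable y x A →
      FOLBox (((Formula.eq x y).and A).imp (A.subst y x))
  | axMix {A : Formula} {x : ℕ} : FOLBox ((box A).imp (all x A))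
  | axBang {A} : BoxFree A → A ∉ FOL → FOLBox (neg (box A))
  | mp {A B} : FOLBox (A.imp B) → FOLBox A → FOLBox B
  | nec {A} : FOLBox A → FOLBox (box A)

/-- The conjunction of a (nonempty) finite list of formulas. -/
def conjList : List Formula → Formula
  | [] => Formula.eq 0 0
  | [A] => A
  | A :: B :: rest => A.and (conjList (B :: rest))

/-- FOL□-consistency: no finite conjunction of members of Γ has its negation
in FOL□. -/
def Consistent (Γ : Set Formula) : Prop :=
  ∀ L : List Formula, L ≠ [] → (∀ B ∈ L, B ∈ Γ) → ¬ FOLBox (neg (conjList L))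

/-- Maximal FOL□-consistency. -/
def MaxConsistent (Γ : Set Formula) : Prop :=
  Consistent Γ ∧ ∀ A, A ∈ Γ ∨ neg A ∈ Γ

/-- ∃-saturation: whenever ¬∀xA ∈ Γ there is a variable y with
¬A(y/x) ∈ Γ via a ∀□-free substitution. -/
def Saturated (Γ : Set Formula) : Prop :=
  ∀ (x : ℕ) (A : Formula), neg (all x A) ∈ Γ →
    ∃ y : ℕ, Substitutable y x A ∧ neg (A.subst y x) ∈ Γ

/-- MC: the family of all ∃-saturated maximal FOL□-consistent sets. -/
def MC : Set (Set Formula) := {Γ | Saturated Γ ∧ MaxConsistent Γ}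

/-- An elementary disjunction: a formula of the form
`A ∨ ◇B ∨ □C₁ ∨ … ∨ □Cₙ` with A, B, C₁, …, Cₙ □-free. -/
def ElemDisj (D : Formula) : Prop :=
  ∃ (A B : Formula) (Cs : List Formula),
    BoxFree A ∧ BoxFree B ∧ (∀ C ∈ Cs, BoxFree C) ∧
    D = (Cs.map Formula.box).foldl Formula.or (A.or B.dia)

/-- A conjunctive form: a conjunction of elementary disjunctions. -/
def ConjForm (F : Formula) : Prop :=
  ∃ Ds : List Formula, Ds ≠ [] ∧ (∀ D ∈ Ds, ElemDisj D) ∧ F = conjList Ds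

/-- The worlds of the canonical structure: members of MC. -/
def MCW : Type := {Γ : Set Formula // Γ ∈ MC}

/-- The relation ∼_Γ on variables: x ∼_Γ y iff the formula x = y belongs
to Γ. -/
def canonRel (Γ : MCW) (x y : ℕ) : Prop := Formula.eq x y ∈ Γ.val

/-- The canonical structure 𝒜^MC: worlds are the members of MC, the domain
of a world Γ consists of the classes [x]_{∼_Γ} of variables, and a predicate
holds of such classes iff the corresponding atomic formula belongs to Γ. -/
noncomputable def canonicalStructure (h : Nonempty MCW) : Structure where
  W := MCW
  wNonempty := h
  D := fun Γ => Quot (canonRel Γ)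
  dNonempty := fun Γ => ⟨Quot.mk _ 0⟩
  I := fun j Γ ds =>
    ∃ xs : List ℕ, ds = xs.map (Quot.mk (canonRel Γ)) ∧ Formula.atom j xs ∈ Γ.val

/-- The canonical valuation v^MC: v^MC(x, Γ) = [x]_{∼_Γ}. -/
noncomputable def canonicalVal (h : Nonempty MCW) : Valuation (canonicalStructure h) :=
  fun x Γ => Quot.mk (canonRel Γ) x

/-! ### Propositional reasoning in FOL□ -/

/-- A truth assignment to formulas respecting negation and implication. -/
def IsAssignment (f : Formula → Prop) : Prop :=
  (∀ B, f (neg B) ↔ ¬ f B) ∧ ∀ B C, f (imp B C) ↔ (f B → f C)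

theorem IsAssignment.and {f : Formula → Prop} (hf : IsAssignment f) (A B : Formula) :
    f (A.and B) ↔ f A ∧ f B := by
  simp [Formula.and, hf.1, hf.2]

theorem IsAssignment.conjList {f : Formula → Prop} (hf : IsAssignment f) :
    ∀ {L : List Formula}, L ≠ [] → (f (conjList L) ↔ ∀ B ∈ L, f B)
  | [], h => absurd rfl h
  | [A], _ => by simp [FOLBoxPaper.conjList]
  | A :: B :: L, _ => by
    rw [FOLBoxPaper.conjList, hf.and, hf.conjList (List.cons_ne_nil B L)]
    simp

theorem FOLBox.of_forall {A : Formula} (h : ∀ f, IsAssignment f → f A) : FOLBox A :=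
  .taut fun f hn hi => h f ⟨hn, hi⟩

theorem FOLBox.of_one {A B : Formula} (hA : FOLBox A)
    (h : ∀ f, IsAssignment f → f A → f B) : FOLBox B :=
  .mp (.of_forall fun f hf => (hf.2 _ _).2 (h f hf)) hA

theorem FOLBox.of_two {A B C : Formula} (hA : FOLBox A) (hB : FOLBox B)
    (h : ∀ f, IsAssignment f → f A → f B → f C) : FOLBox C :=
  .mp (.of_one hA fun f hf hfA => (hf.2 _ _).2 (h f hf hfA)) hB

theorem FOLBox.imp_trans {A B C : Formula} (h₁ : FOLBox (A.imp B)) (h₂ : FOLBox (B.imp C)) :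
    FOLBox (A.imp C) :=
  .of_two h₁ h₂ fun f hf => by simp only [hf.2]; tauto

/-! ### Substitution and fresh variables -/

theorem subst_self (A : Formula) (x : ℕ) : A.subst x x = A := by
  have h : ∀ z, (if z = x then x else z) = z := fun z => by split_ifs <;> simp_all
  induction A with
  | atom j l => simp [subst, h]
  | eq a b => simp [subst, h]
  | neg A ih => simp [subst, ih]
  | imp A B ihA ihB => simp [subst, ihA, ihB]
  | all z A ih => simp [subst, ih]
  | box A ih => simp [subst]

theorem substitutable_self (A : Formula) (x : ℕ) : Substitutable x x A := by
  induction A with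
  | atom | eq | box => trivial
  | neg A ih => exact ih
  | imp A B ihA ihB => exact ⟨ihA, ihB⟩
  | all z A ih =>
    by_cases h : z = x
    · exact .inl h
    · exact .inr (.inr ⟨h, ih⟩)

/-- The variable `y` occurs neither free nor bound in `A` outside the scope of □. -/
def Fresh (y : ℕ) : Formula → Prop
  | .atom _ args => y ∉ args
  | .eq a b => y ≠ a ∧ y ≠ b
  | .neg A => Fresh y A
  | .imp A B => Fresh y A ∧ Fresh y B
  | .all z A => z ≠ y ∧ Fresh y A
  | .box _ => True

theorem eventually_fresh (A : Formula) : ∀ᶠ y in Filter.atTop, Fresh y A := by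
  induction A with
  | atom j l =>
    simp only [Fresh]
    rw [← Nat.cofinite_eq_atTop]
    exact (List.finite_toSet l).eventually_cofinite_notMem
  | eq a b => exact (Filter.eventually_ne_atTop a).and (Filter.eventually_ne_atTop b)
  | neg A ih => exact ih
  | imp A B ihA ihB => exact ihA.and ihB
  | all z A ih => exact ((Filter.eventually_ne_atTop z).mono fun _ h => h.symm).and ih
  | box A ih => exact .of_forall fun _ => trivial

theorem exists_fresh (L : List Formula) : ∃ y, ∀ A ∈ L, Fresh y A := by
  have h : ∀ᶠ y in Filter.atTop, ∀ A ∈ L, Fresh y A := by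
    induction L with
    | nil => simp
    | cons A L ih =>
      simp only [List.mem_cons, forall_eq_or_imp]
      exact (eventually_fresh A).and ih
  exact h.exists

theorem Fresh.not_freeIn {y : ℕ} {A : Formula} (h : Fresh y A) : ¬ FreeIn y A := by
  induction A with
  | atom j l => exact h
  | eq a b => exact not_or.2 h
  | neg A ih => exact ih h
  | imp A B ihA ihB => exact not_or.2 ⟨ihA h.1, ihB h.2⟩
  | all z A ih => exact fun h' => ih h.2 h'.2
  | box A ih => exact id

theorem Fresh.substitutable {y : ℕ} {A : Formula} (h : Fresh y A) (x : ℕ) :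
    Substitutable y x A := by
  induction A with
  | atom | eq | box => trivial
  | neg A ih => exact ih h
  | imp A B ihA ihB => exact ⟨ihA h.1, ihB h.2⟩
  | all z A ih => exact .inr (.inr ⟨h.1, ih h.2⟩)

theorem Fresh.substitutable_subst {y : ℕ} {A : Formula} (h : Fresh y A) (x : ℕ) :
    Substitutable x y (A.subst y x) := by
  induction A with
  | atom | eq | box => trivial
  | neg A ih => exact ih h
  | imp A B ihA ihB => exact ⟨ihA h.1, ihB h.2⟩
  | all z A ih =>
    rw [subst]
    split_ifs with hz
    · exact .inr (.inl h.2.not_freeIn)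
    · exact .inr (.inr ⟨hz, ih h.2⟩)

theorem map_eq_self {α : Type*} {f : α → α} {l : List α} (h : ∀ a ∈ l, f a = a) : l.map f = l :=
  (List.map_congr_left h).trans (List.map_id' l)

theorem subst_of_not_freeIn {x : ℕ} {A : Formula} (h : ¬ FreeIn x A) (y : ℕ) :
    A.subst y x = A := by
  induction A with
  | atom j l =>
    have h' : x ∉ l := h
    simp only [subst, Formula.atom.injEq, true_and]
    exact map_eq_self fun a ha => if_neg fun e : a = x => h' (e ▸ ha)
  | eq a b =>
    simp only [FreeIn, not_or] at h
    simp [subst, Ne.symm h.1, Ne.symm h.2]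
  | neg A ih => simp [subst, ih h]
  | imp A B ihA ihB =>
    simp only [FreeIn, not_or] at h
    simp [subst, ihA h.1, ihB h.2]
  | all z A ih =>
    by_cases hz : z = x
    · simp [subst, hz]
    · simp [subst, hz, ih fun h' => h ⟨hz, h'⟩]
  | box A ih => rfl

theorem not_freeIn_subst {x y : ℕ} (h : x ≠ y) (A : Formula) : ¬ FreeIn x (A.subst y x) := by
  have key : ∀ z, x ≠ if z = x then y else z := fun z => by
    split_ifs with hz
    · exact h
    · exact Ne.symm hz
  induction A with
  | atom j l =>
    intro hl
    obtain ⟨z, -, hz⟩ := List.mem_map.1 (show x ∈ l.map _ from hl)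
    exact key z hz.symm
  | eq a b => exact not_or.2 ⟨key a, key b⟩
  | neg A ih => exact ih
  | imp A B ihA ihB => exact not_or.2 ⟨ihA, ihB⟩
  | all z A ih =>
    rw [subst]
    split_ifs with hz
    · exact fun h' => h'.1 hz
    · exact fun h' => ih h'.2
  | box A ih => exact id

theorem Fresh.subst_subst {y : ℕ} {A : Formula} (h : Fresh y A) (x : ℕ) :
    (A.subst y x).subst x y = A := by
  have key : ∀ z, y ≠ z → (if (if z = x then y else z) = y then x
      else (if z = x then y else z)) = z := by
    intro z hz
    split_ifs <;> simp_all
  induction A with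
  | atom j l =>
    simp only [subst, List.map_map, Formula.atom.injEq, true_and]
    exact map_eq_self fun a ha => key a fun e => h (e ▸ ha)
  | eq a b => simp only [subst, key a h.1, key b h.2]
  | neg A ih => simp [subst, ih h]
  | imp A B ihA ihB => simp [subst, ihA h.1, ihB h.2]
  | all z A ih =>
    by_cases hz : z = x
    · simp [subst, hz, hz ▸ h.1, subst_of_not_freeIn h.2.not_freeIn]
    · simp [subst, hz, h.1, ih h.2]
  | box A ih => rfl

theorem BoxFree.subst {A : Formula} (h : BoxFree A) (y x : ℕ) : BoxFree (A.subst y x) := by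
  induction A with
  | atom | eq => trivial
  | neg A ih => exact ih h
  | imp A B ihA ihB => exact ⟨ihA h.1, ihB h.2⟩
  | all z A ih =>
    rw [Formula.subst]
    split_ifs
    · exact h
    · exact ih h
  | box A ih => exact h

/-- The number of connectives, quantifiers and modal operators of a formula. -/
def complexity : Formula → ℕ
  | .atom _ _ => 0
  | .eq _ _ => 0
  | .neg A => complexity A + 1
  | .imp A B => complexity A + complexity B + 1
  | .all _ A => complexity A + 1
  | .box A => complexity A + 1

theorem complexity_subst (A : Formula) (y x : ℕ) : complexity (A.subst y x) = complexity A := by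
  induction A with
  | atom | eq | box => rfl
  | neg A ih => simp [subst, complexity, ih]
  | imp A B ihA ihB => simp [subst, complexity, ihA, ihB]
  | all z A ih =>
    rw [subst]
    split_ifs <;> simp [complexity, ih]

theorem freeIn_conjList {x : ℕ} : ∀ {L : List Formula}, L ≠ [] → FreeIn x (conjList L) →
    ∃ B ∈ L, FreeIn x B
  | [], h, _ => absurd rfl h
  | [A], _, hx => ⟨A, by simp, hx⟩
  | A :: B :: L, _, hx => by
    rcases hx with hx | hx
    · exact ⟨A, by simp, hx⟩
    · obtain ⟨C, hC, h⟩ := freeIn_conjList (List.cons_ne_nil B L) hx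
      exact ⟨C, List.mem_cons_of_mem _ hC, h⟩

/-! ### Quantifier reasoning in FOL□ -/

theorem FOLBox.gen {A : Formula} (h : FOLBox A) (x : ℕ) : FOLBox (all x A) :=
  .mp .axMix (.nec h)

theorem FOLBox.inst {A : Formula} (h : FOLBox A) {x y : ℕ} (hs : Substitutable y x A) :
    FOLBox (A.subst y x) :=
  .mp (.axAll1 hs) (h.gen x)

theorem FOLBox.all_imp_self (A : Formula) (x : ℕ) : FOLBox ((all x A).imp A) := by
  simpa only [subst_self] using FOLBox.axAll1 (substitutable_self A x)

theorem FOLBox.imp_all {A B : Formula} {x : ℕ} (h : FOLBox (A.imp B)) (hx : ¬ FreeIn x A) :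
    FOLBox (A.imp (all x B)) :=
  .mp (.axAll2 hx) (h.gen x)

theorem FOLBox.all_mono {A B : Formula} (h : FOLBox (A.imp B)) (x : ℕ) :
    FOLBox ((all x A).imp (all x B)) :=
  ((all_imp_self A x).imp_trans h).imp_all fun h' => h'.1 rfl

theorem FOLBox.box_mono {A B : Formula} (h : FOLBox (A.imp B)) :
    FOLBox ((box A).imp (box B)) :=
  .mp .axK (.nec h)

theorem FOLBox.all_subst_imp {A : Formula} {x y : ℕ} (h : Fresh y A) :
    FOLBox ((all y (A.subst y x)).imp (all x A)) := by
  have h₁ := FOLBox.axAll1 (h.substitutable_subst x)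
  rw [h.subst_subst] at h₁
  refine h₁.imp_all ?_
  rintro ⟨hne, hx⟩
  exact not_freeIn_subst (Ne.symm hne) A hx

theorem FOLBox.eq_symm (x y : ℕ) : FOLBox ((Formula.eq x y).imp (Formula.eq y x)) := by
  obtain ⟨u, hu⟩ := exists_fresh [Formula.eq x y]
  obtain ⟨hx, hy⟩ : u ≠ x ∧ u ≠ y := hu (.eq x y) (by simp)
  have h := (FOLBox.axEq (A := .eq u x) (x := u) (y := y) trivial trivial).inst
    (x := u) (y := x) (by simp [Formula.and, Substitutable, subst])
  simp only [Formula.and, subst, hx.symm, hy.symm, if_true, if_false] at h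
  refine .of_two h (.axId (x := x)) fun f hf => ?_
  simp only [hf.1, hf.2]
  tauto

theorem FOLBox.eq_trans (x y z : ℕ) :
    FOLBox ((Formula.eq x y).imp ((Formula.eq y z).imp (Formula.eq x z))) := by
  obtain ⟨u, hu⟩ := exists_fresh [Formula.eq x y, Formula.eq z z]
  obtain ⟨hx, hy⟩ : u ≠ x ∧ u ≠ y := hu (.eq x y) (by simp)
  obtain ⟨hz, -⟩ : u ≠ z ∧ u ≠ z := hu (.eq z z) (by simp)
  have h := (FOLBox.axEq (A := .eq u z) (x := u) (y := x) trivial trivial).inst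
    (x := u) (y := y) (by simp [Formula.and, Substitutable, subst])
  simp only [Formula.and, subst, hx.symm, hz.symm, if_true, if_false] at h
  refine .of_two h (eq_symm x y) fun f hf => ?_
  simp only [hf.1, hf.2]
  tauto

theorem FOLBox.atom_congr (j x y : ℕ) (l₁ l₂ : List ℕ) :
    FOLBox ((Formula.eq x y).imp ((Formula.atom j (l₁ ++ x :: l₂)).imp
      (.atom j (l₁ ++ y :: l₂)))) := by
  obtain ⟨u, hu⟩ := exists_fresh [Formula.eq x y, .atom 0 l₁, .atom 0 l₂]
  obtain ⟨hx, hy⟩ : u ≠ x ∧ u ≠ y := hu (.eq x y) (by simp)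
  have h₁ : u ∉ l₁ := hu (.atom 0 l₁) (by simp)
  have h₂ : u ∉ l₂ := hu (.atom 0 l₂) (by simp)
  have map_eq : ∀ (l : List ℕ) (y : ℕ), u ∉ l → l.map (fun z => if z = u then y else z) = l :=
    fun l y hl => map_eq_self fun a ha => if_neg fun e : a = u => hl (e ▸ ha)
  have h := (FOLBox.axEq (A := .atom j (l₁ ++ u :: l₂)) (x := u) (y := y) trivial trivial).inst
    (x := u) (y := x) (by simp [Formula.and, Substitutable, subst])
  simp only [Formula.and, subst, hy.symm, if_true, if_false, List.map_append, List.map_cons,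
    map_eq _ _ h₁, map_eq _ _ h₂] at h
  refine .of_one h fun f hf => ?_
  simp only [hf.1, hf.2]
  tauto

/-! ### Members of MC -/

section MC

variable {Γ : Set Formula}

theorem not_mem_of_neg_mem (hc : Consistent Γ) {A : Formula} (h : neg A ∈ Γ) : A ∉ Γ := by
  refine fun hA => hc [A, neg A] (by simp) (by simp [h, hA]) (.of_forall fun f hf => ?_)
  simp [conjList, hf.and, hf.1]

theorem neg_mem_iff (hΓ : MaxConsistent Γ) {A : Formula} : neg A ∈ Γ ↔ A ∉ Γ :=
  ⟨not_mem_of_neg_mem hΓ.1, (hΓ.2 A).resolve_left⟩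

theorem mem_of_FOLBox (hΓ : MaxConsistent Γ) {A : Formula} (h : FOLBox A) : A ∈ Γ := by
  refine (hΓ.2 A).resolve_right fun hn =>
    hΓ.1 [neg A] (by simp) (by simp [hn]) (.of_one h fun f hf => ?_)
  simp [conjList, hf.1]

theorem mem_mp (hΓ : MaxConsistent Γ) {A B : Formula} (h : A.imp B ∈ Γ) (hA : A ∈ Γ) :
    B ∈ Γ := by
  refine (hΓ.2 B).resolve_right fun hn =>
    hΓ.1 [A.imp B, A, neg B] (by simp) (by simp [h, hA, hn]) (.of_forall fun f hf => ?_)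
  simp only [conjList, hf.and, hf.1, hf.2]
  tauto

theorem isAssignment_mem (hΓ : MaxConsistent Γ) : IsAssignment (· ∈ Γ) := by
  refine ⟨fun _ => neg_mem_iff hΓ, fun A B => ⟨mem_mp hΓ, fun h => ?_⟩⟩
  by_cases hA : A ∈ Γ
  · exact mem_mp hΓ (mem_of_FOLBox hΓ (.of_forall fun f hf => by simp only [hf.2]; tauto)) (h hA)
  · exact mem_mp hΓ (mem_of_FOLBox hΓ (.of_forall fun f hf => by
      simp only [hf.1, hf.2]; tauto)) ((neg_mem_iff hΓ).2 hA)

theorem mem_mp_FOLBox (hΓ : MaxConsistent Γ) {A B : Formula} (h : FOLBox (A.imp B))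
    (hA : A ∈ Γ) : B ∈ Γ :=
  mem_mp hΓ (mem_of_FOLBox hΓ h) hA

theorem canonRel_equivalence (Γ : MCW) : Equivalence (canonRel Γ) where
  refl _ := mem_of_FOLBox Γ.2.2 .axId
  symm {x y} := mem_mp_FOLBox Γ.2.2 (.eq_symm x y)
  trans {x y z} h₁ h₂ := mem_mp Γ.2.2 (mem_mp_FOLBox Γ.2.2 (.eq_trans x y z) h₁) h₂

theorem quot_mk_canonRel_iff {Γ : MCW} {x y : ℕ} :
    Quot.mk (canonRel Γ) x = Quot.mk (canonRel Γ) y ↔ canonRel Γ x y := by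
  rw [Quot.eq, (canonRel_equivalence Γ).eqvGen_iff]

theorem atom_mem_of_map_eq (Γ : MCW) (j : ℕ) (l : List ℕ) : ∀ xs ys : List ℕ,
    xs.map (Quot.mk (canonRel Γ)) = ys.map (Quot.mk (canonRel Γ)) →
    Formula.atom j (l ++ xs) ∈ Γ.val → Formula.atom j (l ++ ys) ∈ Γ.val := by
  intro xs
  induction xs generalizing l with
  | nil =>
    intro ys h
    obtain rfl : ys = [] := by simpa using h.symm
    exact id
  | cons x xs ih =>
    rintro (_ | ⟨y, ys⟩) h hm
    · simp at h
    · simp only [List.map_cons, List.cons.injEq] at h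
      have := mem_mp Γ.2.2 (mem_mp_FOLBox Γ.2.2 (.atom_congr j x y l xs)
        (quot_mk_canonRel_iff.1 h.1)) hm
      simpa using ih (l ++ [y]) ys h.2 (by simpa using this)

/-- Every variable is identified, in an ∃-saturated maximal consistent set, with one that is
substitutable in a given formula. -/
theorem exists_eq_substitutable (hΓ : Γ ∈ MC) (A : Formula) (x y : ℕ) :
    ∃ z, Substitutable z x A ∧ Formula.eq z y ∈ Γ := by
  obtain rfl | hxy := eq_or_ne x y
  · exact ⟨x, substitutable_self A x, mem_of_FOLBox hΓ.2 .axId⟩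
  set B : Formula := (A.imp A).imp (neg (.eq x y)) with hB
  have h₁ : FOLBox ((all x B).imp (all x (neg (.eq x y)))) :=
    .all_mono (.of_forall fun f hf => by simp only [hB, hf.1, hf.2]; tauto) x
  have h₂ := FOLBox.axAll1 (A := neg (.eq x y)) (x := x) (y := y) trivial
  simp only [subst, hxy.symm, if_true, if_false] at h₂
  have h₃ : FOLBox (neg (all x B)) := .of_two (h₁.imp_trans h₂) (.axId (x := y)) fun f hf => by
    simp only [hf.1, hf.2]; tauto
  obtain ⟨z, hz, hm⟩ := hΓ.1 x B (mem_of_FOLBox hΓ.2 h₃)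
  refine ⟨z, hz.1.1, ?_⟩
  refine mem_mp_FOLBox hΓ.2 (.of_forall fun f hf => ?_) hm
  simp only [hB, subst, hxy.symm, if_true, if_false, hf.1, hf.2]
  tauto

end MC

/-! ### The Lindenbaum–Henkin construction -/

/-- An injective numbering of formulas. -/
def encodeFormula : Formula → ℕ
  | .atom j l => Nat.pair 0 (Nat.pair j (Encodable.encode l))
  | .eq a b => Nat.pair 1 (Nat.pair a b)
  | .neg A => Nat.pair 2 (encodeFormula A)
  | .imp A B => Nat.pair 3 (Nat.pair (encodeFormula A) (encodeFormula B))
  | .all x A => Nat.pair 4 (Nat.pair x (encodeFormula A))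
  | .box A => Nat.pair 5 (encodeFormula A)

theorem encodeFormula_injective : Function.Injective encodeFormula := by
  intro A
  induction A with
  | atom | eq => intro B h; cases B <;> simp_all [encodeFormula, Nat.pair_eq_pair]
  | neg A ih | box A ih =>
    intro B h
    cases B <;> simp only [encodeFormula, Nat.pair_eq_pair] at h <;> try omega
    rw [ih h.2]
  | all x A ih =>
    intro B h
    cases B <;> simp only [encodeFormula, Nat.pair_eq_pair] at h <;> try omega
    rw [h.2.1, ih h.2.2]
  | imp A B ihA ihB =>
    intro C h
    cases C <;> simp only [encodeFormula, Nat.pair_eq_pair] at h <;> try omega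
    rw [ihA h.2.1, ihB h.2.2]

instance : Countable Formula := encodeFormula_injective.countable

instance : Nonempty Formula := ⟨.eq 0 0⟩

/-- A nonempty list of formulas whose conjunction is not refutable in FOL□. -/
def ListConsistent (L : List Formula) : Prop := L ≠ [] ∧ ¬ FOLBox (neg (conjList L))

theorem FOLBox.neg_conjList_mono {L L' : List Formula} (hL : L ≠ []) (h : FOLBox (neg (conjList L)))
    (hsub : L ⊆ L') : FOLBox (neg (conjList L')) := by
  have hL' : L' ≠ [] := fun e => hL (List.subset_nil.1 (e ▸ hsub))
  refine .of_one h fun f hf => ?_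
  rw [hf.1, hf.1, hf.conjList hL, hf.conjList hL']
  exact fun h₁ h₂ => h₁ fun B hB => h₂ B (hsub hB)

theorem ListConsistent.cons_or {L : List Formula} (hL : ListConsistent L) (A : Formula) :
    ListConsistent (A :: L) ∨ ListConsistent (neg A :: L) := by
  by_contra! h
  have h₁ : FOLBox (neg (conjList (A :: L))) := by
    by_contra h'; exact h.1 ⟨by simp, h'⟩
  have h₂ : FOLBox (neg (conjList (neg A :: L))) := by
    by_contra h'; exact h.2 ⟨by simp, h'⟩
  refine hL.2 (.of_two h₁ h₂ fun f hf => ?_)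
  rw [hf.1, hf.1, hf.1, hf.conjList hL.1, hf.conjList (by simp), hf.conjList (by simp)]
  simp only [List.mem_cons, forall_eq_or_imp, hf.1]
  tauto

theorem ListConsistent.witness {L : List Formula} (hL : ListConsistent L) {x y : ℕ} {A : Formula}
    (hA : neg (all x A) ∈ L) (hy : ∀ B ∈ L, Fresh y B) :
    ListConsistent (neg (A.subst y x) :: L) := by
  refine ⟨by simp, fun h => hL.2 ?_⟩
  have h₁ : FOLBox ((conjList L).imp (A.subst y x)) := .of_one h fun f hf => by
    rw [hf.1, hf.2, hf.conjList hL.1, hf.conjList (by simp)]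
    simp only [List.mem_cons, forall_eq_or_imp, hf.1]
    tauto
  have hfree : ¬ FreeIn y (conjList L) := fun hf => by
    obtain ⟨B, hB, hyB⟩ := freeIn_conjList hL.1 hf
    exact (hy B hB).not_freeIn hyB
  have h₂ := (h₁.imp_all hfree).imp_trans (.all_subst_imp (hy _ hA).2)
  refine .of_one h₂ fun f hf => ?_
  rw [hf.2, hf.1]
  intro h₃ h₄
  exact (hf.1 _).1 ((hf.conjList hL.1).1 h₄ _ hA) (h₃ h₄)

theorem ListConsistent.extend {L : List Formula} (hL : ListConsistent L) (A : Formula) :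
    ∃ L', ListConsistent L' ∧ L ⊆ L' ∧ (A ∈ L' ∨ neg A ∈ L') ∧
      ∀ x B, A = neg (all x B) → A ∈ L' ∧ (∃ y, Substitutable y x B ∧ neg (B.subst y x) ∈ L') ∨
        neg A ∈ L' := by
  rcases hL.cons_or A with h | h
  · by_cases hA : ∃ x B, A = neg (all x B)
    · obtain ⟨x, B, rfl⟩ := hA
      obtain ⟨y, hy⟩ := exists_fresh (neg (all x B) :: L)
      refine ⟨_, h.witness (x := x) (A := B) (by simp) hy, fun C hC => by simp [hC], by simp, ?_⟩
      rintro x' B' ⟨⟩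
      have hyB : Fresh y (neg (all x B)) := hy _ (by simp)
      exact .inl ⟨by simp, y, hyB.2.substitutable x, by simp⟩
    · exact ⟨_, h, by simp, by simp, fun x B e => absurd ⟨x, B, e⟩ hA⟩
  · exact ⟨_, h, by simp, by simp, fun _ _ _ => .inr (by simp)⟩

theorem exists_mem_MC {A : Formula} (hA : ¬ FOLBox A) : ∃ Γ ∈ MC, neg A ∈ Γ := by
  obtain ⟨e, he⟩ := exists_surjective_nat Formula
  have h₀ : ListConsistent [neg A] := ⟨by simp, fun h => hA (.of_one h fun f hf => by
    simp [conjList, hf.1])⟩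
  choose g hg hsub hmem hwit using
    fun (L : {L // ListConsistent L}) (B : Formula) => L.2.extend B
  let T : ℕ → {L // ListConsistent L} :=
    fun n => n.rec ⟨_, h₀⟩ fun k L => ⟨g L (e k), hg L (e k)⟩
  have hT : ∀ n, (T (n + 1)).1 = g (T n) (e n) := fun _ => rfl
  have hmono : Monotone fun n => {B | B ∈ (T n).1} := monotone_nat_of_le_succ fun n B hB => by
    change B ∈ (T (n + 1)).1
    rw [hT]
    exact hsub (T n) (e n) hB
  let Γ : Set Formula := {B | ∃ n, B ∈ (T n).1}
  have hfin : ∀ L : List Formula, (∀ B ∈ L, B ∈ Γ) → ∃ n, L ⊆ (T n).1 := by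
    intro L
    induction L with
    | nil => exact fun _ => ⟨0, by simp⟩
    | cons B L ih =>
      intro h
      obtain ⟨n, hn⟩ := ih fun C hC => h C (by simp [hC])
      obtain ⟨m, hm⟩ := h B (by simp)
      refine ⟨max n m, List.cons_subset.2 ⟨hmono (le_max_right n m) hm, fun C hC => ?_⟩⟩
      exact hmono (le_max_left n m) (hn hC)
  have hcons : Consistent Γ := fun L hL h hd => by
    obtain ⟨n, hn⟩ := hfin L h
    exact (T n).2.2 (hd.neg_conjList_mono hL hn)
  refine ⟨Γ, ⟨fun x B hB => ?_, hcons, fun B => ?_⟩, 0, by simp [T]⟩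
  · obtain ⟨n, hn⟩ := he (neg (all x B))
    rcases hwit (T n) (e n) x B hn with ⟨-, y, hy, h⟩ | h
    · exact ⟨y, hy, n + 1, h⟩
    · exact absurd hB (not_mem_of_neg_mem hcons ⟨n + 1, hn ▸ h⟩)
  · obtain ⟨n, rfl⟩ := he B
    exact (hmem (T n) (e n)).imp (fun h => ⟨n + 1, h⟩) fun h => ⟨n + 1, h⟩

/-! ### Semantics -/

theorem updateVal_same {M : Structure} (v : Valuation M) (x : ℕ) (w : M.W) (a : M.D w) :
    updateVal v x w a x w = a := by
  simp [updateVal]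

theorem updateVal_of_ne {M : Structure} (v : Valuation M) {x y : ℕ} (h : y ≠ x) (w : M.W)
    (a : M.D w) : updateVal v x w a y w = v y w := by
  simp [updateVal, h]

theorem sat_congr {M : Structure} {w : M.W} (A : Formula) : ∀ {v v' : Valuation M},
    (∀ x, FreeIn x A → v x w = v' x w) → (Sat M v w A ↔ Sat M v' w A) := by
  induction A with
  | atom j l =>
    intro v v' h
    have : l.map (fun z => v z w) = l.map fun z => v' z w := List.map_congr_left h
    simp only [Sat, this]
  | eq a b => intro v v' h; simp only [Sat, h a (.inl rfl), h b (.inr rfl)]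
  | neg A ih => intro v v' h; simp only [Sat, ih h]
  | imp A B ihA ihB =>
    intro v v' h
    simp only [Sat, ihA fun x hx => h x (.inl hx), ihB fun x hx => h x (.inr hx)]
  | all z A ih =>
    intro v v' h
    refine forall_congr' fun a => ih fun x hx => ?_
    by_cases hz : x = z
    · subst hz; simp only [updateVal_same]
    · simp only [updateVal_of_ne _ hz, h x ⟨Ne.symm hz, hx⟩]
  | box A ih => intro v v' _; rfl

theorem sat_subst {M : Structure} {w : M.W} {x y : ℕ} (A : Formula) : ∀ {v : Valuation M},
    Substitutable y x A → (Sat M v w (A.subst y x) ↔ Sat M (updateVal v x w (v y w)) w A) := by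
  have key : ∀ (v : Valuation M) (z : ℕ),
      v (if z = x then y else z) w = updateVal v x w (v y w) z w := by
    intro v z
    split_ifs with hz
    · rw [hz, updateVal_same]
    · rw [updateVal_of_ne v hz]
  induction A with
  | atom j l => intro v _; simp only [subst, Sat, List.map_map, Function.comp_def, key]
  | eq a b => intro v _; simp only [subst, Sat, key]
  | neg A ih => intro v h; simp only [subst, Sat, ih h]
  | imp A B ihA ihB => intro v h; simp only [subst, Sat, ihA h.1, ihB h.2]
  | all z A ih =>
    intro v h
    by_cases hx : FreeIn x (all z A)
    · have hzy := (h.resolve_left hx.1).resolve_left (not_not.2 hx.2)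
      rw [subst, if_neg hx.1]
      refine forall_congr' fun a => ?_
      rw [ih hzy.2, updateVal_of_ne _ hzy.1.symm]
      refine sat_congr A fun u _ => ?_
      by_cases huz : u = z
      · subst huz; rw [updateVal_same, updateVal_of_ne _ hx.1, updateVal_same]
      · rw [updateVal_of_ne (updateVal _ _ _ _) huz]
        by_cases hux : u = x
        · subst hux; rw [updateVal_same, updateVal_same]
        · rw [updateVal_of_ne _ hux, updateVal_of_ne _ huz, updateVal_of_ne _ hux]
    · rw [subst_of_not_freeIn hx]
      exact sat_congr _ fun u hu => (updateVal_of_ne v (fun e : u = x => hx (e ▸ hu)) w _).symm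
  | box A ih => intro v _; rfl

/-! ### The truth lemma -/

theorem truth_lemma_of_boxFree (hne : Nonempty MCW) (n : ℕ) : ∀ (A : Formula),
    complexity A = n → BoxFree A → ∀ Γ : MCW,
    (Sat (canonicalStructure hne) (canonicalVal hne) Γ A ↔ A ∈ Γ.val) := by
  induction n using Nat.strong_induction_on with
  | _ n ih =>
  intro A hn hA Γ
  cases A with
  | atom j l =>
    constructor
    · rintro ⟨xs, hxs, hm⟩
      exact atom_mem_of_map_eq Γ j [] xs l hxs.symm hm
    · exact fun h => ⟨l, rfl, h⟩
  | eq a b => exact quot_mk_canonRel_iff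
  | neg A =>
    exact (not_congr (ih _ (by simp [← hn, complexity]) A rfl hA Γ)).trans
      (neg_mem_iff Γ.2.2).symm
  | imp A B =>
    exact (imp_congr (ih _ (by simp only [← hn, complexity]; omega) A rfl hA.1 Γ)
      (ih _ (by simp only [← hn, complexity]; omega) B rfl hA.2 Γ)).trans
      ((isAssignment_mem Γ.2.2).2 A B).symm
  | all x A =>
    have hsubst : ∀ y, Substitutable y x A → (A.subst y x ∈ Γ.val ↔
        Sat (canonicalStructure hne)
          (updateVal (canonicalVal hne) x Γ (Quot.mk (canonRel Γ) y)) Γ A) := by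
      intro y hy
      exact (ih _ (by simp [← hn, complexity, complexity_subst]) (A.subst y x) rfl
        (BoxFree.subst (A := A) hA y x) Γ).symm.trans (sat_subst A hy)
    constructor
    · intro h
      by_contra hm
      obtain ⟨y, hy, hyn⟩ := Γ.2.1 x A ((neg_mem_iff Γ.2.2).2 hm)
      exact not_mem_of_neg_mem Γ.2.2.1 hyn ((hsubst y hy).2 (h _))
    · rintro h ⟨y⟩
      obtain ⟨z, hz, hzy⟩ := exists_eq_substitutable Γ.2 A x y
      rw [← quot_mk_canonRel_iff.2 hzy]
      exact (hsubst z hz).1 (mem_mp_FOLBox Γ.2.2 (.axAll1 hz) h)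
  | box A => exact hA.elim

theorem exists_not_sat_of_not_FOLBox (hne : Nonempty MCW) {A : Formula} (hA : BoxFree A)
    (h : ¬ FOLBox A) : ∃ v w, ¬ Sat (canonicalStructure hne) v w A := by
  obtain ⟨Δ, hΔ, hn⟩ := exists_mem_MC h
  exact ⟨canonicalVal hne, ⟨Δ, hΔ⟩, fun hs =>
    not_mem_of_neg_mem hΔ.2.1 hn ((truth_lemma_of_boxFree hne _ A rfl hA ⟨Δ, hΔ⟩).1 hs)⟩

theorem FOLBox_of_mem_FOL (hne : Nonempty MCW) {A : Formula} (h : A ∈ FOL) : FOLBox A := by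
  by_contra hA
  obtain ⟨v, w, hs⟩ := exists_not_sat_of_not_FOLBox hne h.1 hA
  exact hs (h.2 _ v w)

theorem not_FOLBox_of_FOLBox_neg (hne : Nonempty MCW) {A : Formula} (h : FOLBox (neg A)) :
    ¬ FOLBox A := by
  obtain ⟨Γ⟩ := hne
  exact fun hA => not_mem_of_neg_mem Γ.2.2.1 (mem_of_FOLBox Γ.2.2 h) (mem_of_FOLBox Γ.2.2 hA)

/-- Every formula is equivalent to a □-free one, both provably in FOL□ and in the canonical
structure. -/
theorem exists_boxFree_equiv (hne : Nonempty MCW) (A : Formula) : ∃ B, BoxFree B ∧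
    FOLBox (A.imp B) ∧ FOLBox (B.imp A) ∧
    ∀ v w, Sat (canonicalStructure hne) v w A ↔ Sat (canonicalStructure hne) v w B := by
  have refl : ∀ A : Formula, FOLBox (A.imp A) := fun A =>
    .of_forall fun f hf => by simp only [hf.2]; tauto
  induction A with
  | atom j l => exact ⟨.atom j l, trivial, refl _, refl _, fun _ _ => Iff.rfl⟩
  | eq a b => exact ⟨.eq a b, trivial, refl _, refl _, fun _ _ => Iff.rfl⟩
  | neg A ih =>
    obtain ⟨B, hB, h₁, h₂, hs⟩ := ih
    refine ⟨neg B, hB, .of_one h₂ fun f hf => ?_, .of_one h₁ fun f hf => ?_, fun v w => ?_⟩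
    · simp only [hf.1, hf.2]; tauto
    · simp only [hf.1, hf.2]; tauto
    · simp only [Sat, hs]
  | imp A A' ih ih' =>
    obtain ⟨B, hB, h₁, h₂, hs⟩ := ih
    obtain ⟨B', hB', h₁', h₂', hs'⟩ := ih'
    refine ⟨imp B B', ⟨hB, hB'⟩, .of_two h₂ h₁' fun f hf => ?_, .of_two h₁ h₂' fun f hf => ?_,
      fun v w => ?_⟩
    · simp only [hf.2]; tauto
    · simp only [hf.2]; tauto
    · simp only [Sat, hs, hs']
  | all x A ih =>
    obtain ⟨B, hB, h₁, h₂, hs⟩ := ih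
    exact ⟨all x B, hB, h₁.all_mono x, h₂.all_mono x, fun v w => by simp only [Sat, hs]⟩
  | box A ih =>
    obtain ⟨B, hB, h₁, h₂, hs⟩ := ih
    have hId : FOLBox (.eq 0 0) := .axId
    by_cases hF : B ∈ FOL
    · have hA : FOLBox (box A) := .nec (.mp h₂ (FOLBox_of_mem_FOL hne hF))
      refine ⟨.eq 0 0, trivial, .of_one hId fun f hf => ?_, .of_one hA fun f hf => ?_,
        fun v w => iff_of_true (fun v' w' => (hs v' w').2 (hF.2 _ v' w')) rfl⟩
      · simp only [hf.2]; tauto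
      · simp only [hf.2]; tauto
    · have hbang : FOLBox (neg (box B)) := .axBang hB hF
      have hA : FOLBox (neg (box A)) := .of_two hbang h₁.box_mono fun f hf => by
        simp only [hf.1, hf.2]; tauto
      refine ⟨neg (.eq 0 0), trivial, .of_one hA fun f hf => ?_, .of_one hId fun f hf => ?_,
        fun v w => iff_of_false (fun h => ?_) fun h => h rfl⟩
      · simp only [hf.1, hf.2]; tauto
      · simp only [hf.1, hf.2]; tauto
      · obtain ⟨v', w', hn⟩ := exists_not_sat_of_not_FOLBox hne hB
          fun hp => not_FOLBox_of_FOLBox_neg hne hbang (.nec hp)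
        exact hn ((hs v' w').1 (h v' w'))

/-- Truth lemma for the canonical model: for every formula A
and every Γ ∈ MC, 𝒜^MC, v^MC, Γ ⊨ A iff A ∈ Γ. -/
theorem truth_lemma (A : Formula) (Γ : Set Formula) (hΓ : Γ ∈ MC) :
    Sat (canonicalStructure ⟨⟨Γ, hΓ⟩⟩) (canonicalVal ⟨⟨Γ, hΓ⟩⟩) ⟨Γ, hΓ⟩ A ↔
      A ∈ Γ := by
  obtain ⟨B, hB, h₁, h₂, hs⟩ := exists_boxFree_equiv ⟨⟨Γ, hΓ⟩⟩ A
  exact ((hs _ _).trans (truth_lemma_of_boxFree _ _ B rfl hB ⟨Γ, hΓ⟩)).trans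
    ⟨mem_mp_FOLBox hΓ.2 h₂, mem_mp_FOLBox hΓ.2 h₁⟩

end FOLBoxPaper
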